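/- arXiv:1607.03369 — 6 statements merged into one kernel-verified Lean document; each statement's English description precedes it below -/
import Mathlib

section
/- Let β be a real number with 0 < β < 1, set q = 1-β, and let n be a natural number with n ≥ 4. Define t₊ = (3n-4 + √(5n^2-16n+12))/(2(n-1)^2) and t₋ = (3n-4 - √(5n^2-16n+12))/(2(n-1)^2), and set ε_{p1} = log t₊ / log q and ε_{p2} = log t₋ / log q. Then ε_{p1} < ε_{p2}, and the third derivative of the function φ(ε) = (1 - q^ε)^(n-1) vanishes at both ε_{p1} and ε_{p2}. -/
theorem hasDerivAt_one_sub_rpow_pow {q : ℝ} (hq : 0 < q) (m : ℕ) (x : ℝ) :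
    HasDerivAt (fun x : ℝ => (1 - q ^ x) ^ (m + 1))
      (-(Real.log q * (m + 1)) * (q ^ x * (1 - q ^ x) ^ m)) x := by
  have h := (((Real.hasStrictDerivAt_const_rpow hq x).hasDerivAt).const_sub 1).pow (m + 1)
  refine h.congr_deriv ?_
  simp only [Nat.add_sub_cancel]
  push_cast
  ring

theorem iteratedDeriv_three_one_sub_rpow_pow {q : ℝ} (hq : 0 < q) (k : ℕ) (x : ℝ) :
    iteratedDeriv 3 (fun x : ℝ => (1 - q ^ x) ^ (k + 3)) x =
      -(Real.log q ^ 3 * (k + 3)) * q ^ x * (1 - q ^ x) ^ k *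
        ((k + 3) ^ 2 * (q ^ x) ^ 2 - (3 * (k + 3) - 1) * q ^ x + 1) := by
  have hr (x : ℝ) : HasDerivAt (fun x : ℝ => q ^ x) (q ^ x * Real.log q) x :=
    (Real.hasStrictDerivAt_const_rpow hq x).hasDerivAt
  have h₁ : deriv (fun x : ℝ => (1 - q ^ x) ^ (k + 3)) =
      fun x => -(Real.log q * (k + 3)) * (q ^ x * (1 - q ^ x) ^ (k + 2)) := by
    ext x
    rw [(hasDerivAt_one_sub_rpow_pow hq (k + 2) x).deriv]
    push_cast
    ring
  have h₂ : deriv (fun x : ℝ => -(Real.log q * (k + 3)) * (q ^ x * (1 - q ^ x) ^ (k + 2))) =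
      fun x => Real.log q ^ 2 * (k + 3) *
        (q ^ x * ((k + 3) * q ^ x - 1) * (1 - q ^ x) ^ (k + 1)) := by
    ext x
    refine ((((hr x).mul (hasDerivAt_one_sub_rpow_pow hq (k + 1) x)).const_mul
      (-(Real.log q * (k + 3)))).congr_deriv ?_).deriv
    push_cast
    ring
  have h₃ := ((((hr x).mul (((hr x).const_mul ((k : ℝ) + 3)).sub_const 1)).mul
    (hasDerivAt_one_sub_rpow_pow hq k x)).const_mul (Real.log q ^ 2 * (k + 3))).deriv
  rw [iteratedDeriv_succ, iteratedDeriv_succ, iteratedDeriv_one, h₁, h₂]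
  refine h₃.trans ?_
  simp only [Pi.mul_apply]
  ring

/-- Lemma "two": for `q = 1-β`, `0 < β < 1`, `n ≥ 4`, the two inflection points of the
slope of `φ(ε) = (1-q^ε)^(n-1)`, i.e. zeros of its third derivative, are at
`ε_{p1} = log t₊ / log q < ε_{p2} = log t₋ / log q` with
`t₊/₋ = (3n-4 ± √(5n²-16n+12)) / (2(n-1)²)`. -/
theorem stmt_4 (β : ℝ) (hβ0 : 0 < β) (hβ1 : β < 1) (q : ℝ) (hq : q = 1 - β)
    (n : ℕ) (hn : 4 ≤ n)
    (tp tm : ℝ)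
    (htp : tp = (3 * (n : ℝ) - 4 + Real.sqrt (5 * (n : ℝ) ^ 2 - 16 * (n : ℝ) + 12)) /
      (2 * ((n : ℝ) - 1) ^ 2))
    (htm : tm = (3 * (n : ℝ) - 4 - Real.sqrt (5 * (n : ℝ) ^ 2 - 16 * (n : ℝ) + 12)) /
      (2 * ((n : ℝ) - 1) ^ 2))
    (εp1 εp2 : ℝ)
    (hε1 : εp1 = Real.log tp / Real.log q)
    (hε2 : εp2 = Real.log tm / Real.log q) :
    εp1 < εp2 ∧
    iteratedDeriv 3 (fun x : ℝ => (1 - q ^ x) ^ (n - 1)) εp1 = 0 ∧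
    iteratedDeriv 3 (fun x : ℝ => (1 - q ^ x) ^ (n - 1)) εp2 = 0 := by
  obtain ⟨k, rfl⟩ := Nat.exists_eq_add_of_le' hn
  have hq0 : 0 < q := by linarith
  have hlog : Real.log q < 0 := Real.log_neg hq0 (by linarith)
  have hk : (0 : ℝ) ≤ k := k.cast_nonneg
  push_cast at htp htm
  have hdisc : 0 < 5 * ((k : ℝ) + 4) ^ 2 - 16 * ((k : ℝ) + 4) + 12 := by nlinarith
  set s := Real.sqrt (5 * ((k : ℝ) + 4) ^ 2 - 16 * ((k : ℝ) + 4) + 12)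
  have hs : 0 < s := Real.sqrt_pos.2 hdisc
  have hs2 : s ^ 2 = 5 * ((k : ℝ) + 4) ^ 2 - 16 * ((k : ℝ) + 4) + 12 := Real.sq_sqrt hdisc.le
  have hden : 0 < 2 * ((k : ℝ) + 4 - 1) ^ 2 := by
    have : 0 < (k : ℝ) + 4 - 1 := by linarith
    positivity
  have hlt : s < 3 * ((k : ℝ) + 4) - 4 := by nlinarith
  have htm0 : 0 < tm := htm ▸ div_pos (by linarith) hden
  have htmp : tm < tp := by
    rw [htm, htp]
    exact div_lt_div_of_pos_right (by linarith) hden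
  have hroot (t : ℝ) (ht : t * (2 * ((k : ℝ) + 4 - 1) ^ 2) = 3 * ((k : ℝ) + 4) - 4 + s ∨
      t * (2 * ((k : ℝ) + 4 - 1) ^ 2) = 3 * ((k : ℝ) + 4) - 4 - s) :
      ((k : ℝ) + 3) ^ 2 * t ^ 2 - (3 * (k + 3) - 1) * t + 1 = 0 := by
    have hsq : (t * (2 * ((k : ℝ) + 4 - 1) ^ 2) - (3 * ((k : ℝ) + 4) - 4)) ^ 2 = s ^ 2 := by
      rcases ht with h | h <;> rw [h] <;> ring
    refine (mul_eq_zero.1 ?_).resolve_left hden.ne'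
    linear_combination (hsq + hs2) / 2
  have hzero (t : ℝ) (ht0 : 0 < t)
      (ht : ((k : ℝ) + 3) ^ 2 * t ^ 2 - (3 * (k + 3) - 1) * t + 1 = 0) :
      iteratedDeriv 3 (fun x : ℝ => (1 - q ^ x) ^ (k + 4 - 1)) (Real.log t / Real.log q) = 0 := by
    have hqt : q ^ (Real.log t / Real.log q) = t := by
      rw [Real.rpow_def_of_pos hq0, mul_div_cancel₀ _ hlog.ne, Real.exp_log ht0]
    refine (iteratedDeriv_three_one_sub_rpow_pow hq0 k _).trans ?_
    rw [hqt, ht, mul_zero]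
  subst hε1 hε2
  refine ⟨div_lt_div_of_neg_of_lt hlog (Real.log_lt_log htm0 htmp),
    hzero tp (htm0.trans htmp) (hroot tp (.inl ?_)), hzero tm htm0 (hroot tm (.inr ?_))⟩
  · rw [htp, div_mul_cancel₀ _ hden.ne']
  · rw [htm, div_mul_cancel₀ _ hden.ne']
end

section
/- Define, for each natural number n ≥ 4, t₊(n) = (3n-4 + √(5n^2-16n+12))/(2(n-1)^2) and t₋(n) = (3n-4 - √(5n^2-16n+12))/(2(n-1)^2). Then the sequence log(t₋(n)) / log(t₊(n)) tends to 1 as n → ∞. -/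
open Filter

/-- If `n * f n` tends to a positive limit, then `log (f n) / log n` tends to `-1`. -/
theorem tendsto_log_div_log_of_tendsto_natCast_mul {f : ℕ → ℝ} {c : ℝ} (hc : 0 < c)
    (hf : Tendsto (fun n : ℕ => (n : ℝ) * f n) atTop (nhds c)) :
    Tendsto (fun n : ℕ => Real.log (f n) / Real.log n) atTop (nhds (-1)) := by
  have hlog : Tendsto (fun n : ℕ => Real.log n) atTop atTop :=
    Real.tendsto_log_atTop.comp tendsto_natCast_atTop_atTop
  have h : Tendsto (fun n : ℕ => Real.log (n * f n) / Real.log n - 1) atTop (nhds (0 - 1)) :=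
    ((hf.log hc.ne').div_atTop hlog).sub_const 1
  rw [zero_sub] at h
  refine h.congr' ?_
  filter_upwards [hf.eventually (lt_mem_nhds hc), hlog.eventually_gt_atTop 0] with n hn hl
  have hn0 : (n : ℝ) ≠ 0 := left_ne_zero_of_mul hn.ne'
  have hfn : f n ≠ 0 := right_ne_zero_of_mul hn.ne'
  rw [Real.log_mul hn0 hfn]
  field_simp
  ring

theorem tendsto_natCast_mul_inflection (s : ℝ) :
    Tendsto (fun n : ℕ => (n : ℝ) * ((3 * (n : ℝ) - 4 +
      s * Real.sqrt (5 * (n : ℝ) ^ 2 - 16 * (n : ℝ) + 12)) / (2 * ((n : ℝ) - 1) ^ 2)))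
      atTop (nhds ((3 + s * Real.sqrt 5) / 2)) := by
  have hcont : ContinuousAt (fun u : ℝ =>
      (3 - 4 * u + s * Real.sqrt (5 - 16 * u + 12 * u ^ 2)) / (2 * (1 - u) ^ 2)) 0 := by
    refine ContinuousAt.div (by fun_prop) (by fun_prop) (by norm_num)
  have h := hcont.tendsto.comp (tendsto_inv_atTop_nhds_zero_nat (𝕜 := ℝ))
  norm_num at h
  refine h.congr' ?_
  filter_upwards [eventually_ge_atTop 2] with n hn
  have hn2 : (2 : ℝ) ≤ n := by exact_mod_cast hn
  have hn0 : (n : ℝ) ≠ 0 := by positivity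
  have hn1 : (n : ℝ) - 1 ≠ 0 := by linarith
  have hsqrt : Real.sqrt (5 * (n : ℝ) ^ 2 - 16 * n + 12) =
      n * Real.sqrt (5 - 16 * (n : ℝ)⁻¹ + 12 * (n : ℝ)⁻¹ ^ 2) := by
    rw [← Real.sqrt_sq (Nat.cast_nonneg n : (0 : ℝ) ≤ n), ← Real.sqrt_mul (sq_nonneg _),
      Real.sqrt_sq (Nat.cast_nonneg n)]
    congr 1
    field_simp
  have hden : 1 - (n : ℝ)⁻¹ = (n - 1) / n := by field_simp
  have hnum : 3 - 4 * (n : ℝ)⁻¹ = (3 * n - 4) / n := by field_simp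
  simp only [Function.comp_apply]
  rw [hsqrt, hden, hnum]
  generalize Real.sqrt _ = r
  field_simp

/-- The key limit in Theorem 2: with
`t₊(n) = (3n-4 + √(5n²-16n+12))/(2(n-1)²)` and `t₋(n) = (3n-4 - √(5n²-16n+12))/(2(n-1)²)`,
the sequence `log (t₋ n) / log (t₊ n)` tends to `1` as `n → ∞`. -/
theorem stmt_6
    (tp tm : ℕ → ℝ)
    (htp : ∀ n : ℕ, 4 ≤ n →
      tp n = (3 * (n : ℝ) - 4 + Real.sqrt (5 * (n : ℝ) ^ 2 - 16 * (n : ℝ) + 12)) /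
        (2 * ((n : ℝ) - 1) ^ 2))
    (htm : ∀ n : ℕ, 4 ≤ n →
      tm n = (3 * (n : ℝ) - 4 - Real.sqrt (5 * (n : ℝ) ^ 2 - 16 * (n : ℝ) + 12)) /
        (2 * ((n : ℝ) - 1) ^ 2)) :
    Tendsto (fun n : ℕ => Real.log (tm n) / Real.log (tp n)) atTop (nhds 1) := by
  have hp : Tendsto (fun n : ℕ => (n : ℝ) * tp n) atTop
      (nhds ((3 + 1 * Real.sqrt 5) / 2)) := by
    refine (tendsto_natCast_mul_inflection 1).congr' ?_
    filter_upwards [eventually_ge_atTop 4] with n hn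
    rw [htp n hn, one_mul]
  have hm : Tendsto (fun n : ℕ => (n : ℝ) * tm n) atTop
      (nhds ((3 + -1 * Real.sqrt 5) / 2)) := by
    refine (tendsto_natCast_mul_inflection (-1)).congr' ?_
    filter_upwards [eventually_ge_atTop 4] with n hn
    rw [htm n hn, neg_one_mul, ← sub_eq_add_neg]
  have hsqrt5 : Real.sqrt 5 < 3 := by
    rw [Real.sqrt_lt' (by norm_num)]
    norm_num
  have h := (tendsto_log_div_log_of_tendsto_natCast_mul (by linarith) hm).div
    (tendsto_log_div_log_of_tendsto_natCast_mul (by positivity) hp) (by norm_num)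
  rw [div_self (by norm_num)] at h
  refine h.congr' ?_
  filter_upwards [eventually_ge_atTop 2] with n hn
  have hl : Real.log n ≠ 0 := (Real.log_pos (by exact_mod_cast hn)).ne'
  exact div_div_div_cancel_right₀ hl _ _
end

section
/- Fix a real number β with 0 < β < 1 and set q = 1-β. For each natural number n ≥ 4 define ε_{p1}(n) = log((3n-4 + √(5n^2-16n+12))/(2(n-1)^2)) / log q and ε_{p2}(n) = log((3n-4 - √(5n^2-16n+12))/(2(n-1)^2)) / log q. Then the sequence (ε_{p2}(n) - ε_{p1}(n))/ε_{p1}(n) tends to 0 as n → ∞. -/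
open Filter

/-- The two roots of `(x-1)² z² - (3x-4) z + 1` are `w / (x-1)` and `1 / (w (x-1))`
for some `w` in `[1, 3]`. -/
lemma exists_roots_eq {x : ℝ} (hx : 4 ≤ x) :
    ∃ w : ℝ, 1 ≤ w ∧ w ≤ 3 ∧
      (3 * x - 4 + √(5 * x ^ 2 - 16 * x + 12)) / (2 * (x - 1) ^ 2) = w / (x - 1) ∧
      (3 * x - 4 - √(5 * x ^ 2 - 16 * x + 12)) / (2 * (x - 1) ^ 2) = 1 / (w * (x - 1)) := by
  have hs0 := Real.sqrt_nonneg (5 * x ^ 2 - 16 * x + 12)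
  have hs2 := Real.sq_sqrt (show 0 ≤ 5 * x ^ 2 - 16 * x + 12 by nlinarith)
  set s := √(5 * x ^ 2 - 16 * x + 12)
  have hm : 0 < x - 1 := by linarith
  have hu : 0 < 3 * x - 4 + s := by linarith
  have hs : s ≤ 3 * x - 4 := abs_le_of_sq_le_sq' (by nlinarith) (by linarith) |>.2
  refine ⟨(3 * x - 4 + s) / (2 * (x - 1)), ?_, ?_, ?_, ?_⟩
  · rw [le_div_iff₀ (by positivity)]
    linarith
  · rw [div_le_iff₀ (by positivity)]
    linarith
  · field_simp
  · field_simp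
    nlinarith

/-- The relative gap between the logarithms of the two roots is at most
`2 log 3 / (log (x-1) - log 3)`. -/
lemma abs_log_sub_log_div_log_le {x w : ℝ} (hx : 4 < x) (hw1 : 1 ≤ w) (hw3 : w ≤ 3) :
    |(Real.log (1 / (w * (x - 1))) - Real.log (w / (x - 1))) / Real.log (w / (x - 1))| ≤
      2 * Real.log 3 / (Real.log (x - 1) - Real.log 3) := by
  have hm : 0 < x - 1 := by linarith
  have hw : 0 < w := by linarith
  have hlw0 := Real.log_nonneg hw1
  have hlw3 := Real.log_le_log hw hw3
  have hlm : Real.log 3 < Real.log (x - 1) := Real.log_lt_log (by norm_num) (by linarith)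
  rw [one_div, Real.log_inv, Real.log_mul hw.ne' hm.ne', Real.log_div hw.ne' hm.ne', abs_div,
    abs_of_nonpos (by linarith), abs_of_neg (by linarith)]
  apply div_le_div₀ <;> linarith

/-- Theorem 2: the relative uncertain range `(ε_{p2}(n) - ε_{p1}(n))/ε_{p1}(n)` of the
asynchronous monitor tends to `0` as the number of processes `n` goes to infinity, where
`ε_{p1}(n) = log((3n-4 + √(5n²-16n+12))/(2(n-1)²)) / log q` and
`ε_{p2}(n) = log((3n-4 - √(5n²-16n+12))/(2(n-1)²)) / log q` with `q = 1 - β`. -/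
theorem stmt_7 (β : ℝ) (hβ0 : 0 < β) (hβ1 : β < 1) (q : ℝ) (hq : q = 1 - β)
    (εp1 εp2 : ℕ → ℝ)
    (hε1 : ∀ n : ℕ, 4 ≤ n →
      εp1 n = Real.log ((3 * (n : ℝ) - 4 + Real.sqrt (5 * (n : ℝ) ^ 2 - 16 * (n : ℝ) + 12)) /
        (2 * ((n : ℝ) - 1) ^ 2)) / Real.log q)
    (hε2 : ∀ n : ℕ, 4 ≤ n →
      εp2 n = Real.log ((3 * (n : ℝ) - 4 - Real.sqrt (5 * (n : ℝ) ^ 2 - 16 * (n : ℝ) + 12)) /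
        (2 * ((n : ℝ) - 1) ^ 2)) / Real.log q) :
    Tendsto (fun n : ℕ => (εp2 n - εp1 n) / εp1 n) atTop (nhds 0) := by
  have hq0 : Real.log q ≠ 0 := (Real.log_neg (by linarith) (by linarith)).ne
  have hlog : Tendsto (fun n : ℕ => Real.log ((n : ℝ) - 1) - Real.log 3) atTop atTop := by
    refine tendsto_atTop_add_const_right _ _ (Real.tendsto_log_atTop.comp ?_)
    exact tendsto_atTop_add_const_right _ _ tendsto_natCast_atTop_atTop
  refine squeeze_zero_norm' ?_ (hlog.const_div_atTop (2 * Real.log 3))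
  filter_upwards [eventually_ge_atTop 5] with n hn
  have hn' : (4 : ℝ) < n := by exact_mod_cast hn
  obtain ⟨w, hw1, hw3, h1, h2⟩ := exists_roots_eq hn'.le
  rw [hε1 n (by lia), hε2 n (by lia), h1, h2, ← sub_div, div_div_div_cancel_right₀ hq0,
    Real.norm_eq_abs]
  exact abs_log_sub_log_div_log_le hn' hw1 hw3
end

section
/- Let β ∈ (0,1) be real and set q = 1-β; let n ≥ 2 be a natural number, ℓ ≥ 1 a real number, η a real number with 0 < η ≤ 1, and ε_app, ε_mon real numbers with ε_app + ℓ - 1 > 0 and ε_mon + ℓ - 1 > 0. Define f(x) = (1 - q^(x+ℓ-1))^(n-1) and g = 1 - q^(ε_app+ℓ-1), and assume η^(-1/(n-1))·g < 1. Then the two inequalities f(min(ε_app, ε_mon))/f(ε_mon) ≥ η and f(min(ε_app, ε_mon))/f(ε_app) ≥ η both hold if and only if log(1 - η^(1/(n-1))·g)/log q ≤ ε_mon + ℓ - 1 ≤ log(1 - η^(-1/(n-1))·g)/log q. -/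
/-- For positive `b`, a quotient of powers is bounded below by a power iff the bases are. -/
theorem pow_le_pow_div_pow_iff {a b c : ℝ} {m : ℕ} (hm : m ≠ 0) (ha : 0 ≤ a) (hb : 0 < b)
    (hc : 0 ≤ c) : c ^ m ≤ a ^ m / b ^ m ↔ c * b ≤ a := by
  rw [le_div_iff₀ (pow_pos hb m), ← mul_pow, pow_le_pow_iff_left₀ (by positivity) ha hm]


/-- Theorem 4: both Precision `f(min(ε_app,ε_mon))/f(ε_mon) ≥ η` and Recall
`f(min(ε_app,ε_mon))/f(ε_app) ≥ η` hold iff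
`log(1 - η^(1/(n-1))·g)/log q ≤ ε_mon + ℓ - 1 ≤ log(1 - η^(-1/(n-1))·g)/log q`,
where `f(x) = (1 - q^(x+ℓ-1))^(n-1)`, `g = 1 - q^(ε_app+ℓ-1)`, `q = 1-β`. -/
theorem stmt_10 (β : ℝ) (hβ0 : 0 < β) (hβ1 : β < 1) (q : ℝ) (hq : q = 1 - β)
    (n : ℕ) (hn : 2 ≤ n) (ℓ : ℝ) (hℓ : 1 ≤ ℓ)
    (η : ℝ) (hη0 : 0 < η) (hη1 : η ≤ 1)
    (εapp εmon : ℝ) (happ : 0 < εapp + ℓ - 1) (hmon : 0 < εmon + ℓ - 1)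
    (f : ℝ → ℝ) (hf : ∀ x, f x = (1 - q ^ (x + ℓ - 1)) ^ (n - 1))
    (g : ℝ) (hg : g = 1 - q ^ (εapp + ℓ - 1))
    (hbound : η ^ (-(1 / ((n : ℝ) - 1))) * g < 1) :
    (f (min εapp εmon) / f εmon ≥ η ∧ f (min εapp εmon) / f εapp ≥ η) ↔
    (Real.log (1 - η ^ (1 / ((n : ℝ) - 1)) * g) / Real.log q ≤ εmon + ℓ - 1 ∧
     εmon + ℓ - 1 ≤ Real.log (1 - η ^ (-(1 / ((n : ℝ) - 1))) * g) / Real.log q) := by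
  have hq0 : 0 < q := by linarith
  have hq1 : q < 1 := by linarith
  have hm : n - 1 ≠ 0 := by lia
  have hcast : ((n - 1 : ℕ) : ℝ) = (n : ℝ) - 1 := by
    rw [Nat.cast_sub (by lia), Nat.cast_one]
  rw [Real.rpow_neg hη0.le] at hbound ⊢
  obtain ⟨c, hc⟩ : ∃ c, c = η ^ (1 / ((n : ℝ) - 1)) := ⟨_, rfl⟩
  have hc0 : 0 < c := hc ▸ Real.rpow_pos_of_pos hη0 _
  have hcη : c ^ (n - 1) = η := by
    rw [hc, ← hcast, one_div, Real.rpow_inv_natCast_pow hη0.le hm]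
  have hc1 : c ≤ 1 := (pow_le_one_iff_of_nonneg hc0.le hm).1 (hcη ▸ hη1)
  rw [← hc] at hbound ⊢
  have hg0 : 0 < g := by linarith [Real.rpow_lt_one hq0.le hq1 happ]
  have hg1 : g < 1 := by linarith [Real.rpow_pos_of_pos hq0 (εapp + ℓ - 1)]
  have hcg : c * g ≤ g := mul_le_of_le_one_left hg0.le hc1
  obtain ⟨h, hh⟩ : ∃ h, h = 1 - q ^ (εmon + ℓ - 1) := ⟨_, rfl⟩
  have hh0 : 0 < h := by linarith [Real.rpow_lt_one hq0.le hq1 hmon]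
  have hch : c * h ≤ h := mul_le_of_le_one_left hh0.le hc1
  have hmin : f (min εapp εmon) = min g h ^ (n - 1) := by
    rw [hf]
    rcases le_total εapp εmon with hle | hle
    · have := Real.rpow_le_rpow_of_exponent_ge hq0 hq1.le
        (show εapp + ℓ - 1 ≤ εmon + ℓ - 1 by linarith)
      rw [min_eq_left hle, min_eq_left (by linarith), hg]
    · have := Real.rpow_le_rpow_of_exponent_ge hq0 hq1.le
        (show εmon + ℓ - 1 ≤ εapp + ℓ - 1 by linarith)
      rw [min_eq_right hle, min_eq_right (by linarith), hh]
  have hmin0 : 0 ≤ min g h := (lt_min hg0 hh0).le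
  rw [hmin, hf εmon, hf εapp, ← hg, ← hh, ← hcη, ge_iff_le, ge_iff_le,
    pow_le_pow_div_pow_iff hm hmin0 hh0 hc0.le, pow_le_pow_div_pow_iff hm hmin0 hg0 hc0.le,
    Real.log_div_log, Real.log_div_log,
    Real.logb_le_iff_le_rpow_of_base_lt_one hq0 hq1 (by linarith),
    Real.le_logb_iff_rpow_le_of_base_lt_one hq0 hq1 (by linarith), le_min_iff, le_min_iff]
  have hinv : c * h ≤ g ↔ h ≤ c⁻¹ * g := (le_inv_mul_iff₀ hc0).symm
  constructor
  · rintro ⟨⟨hp, -⟩, -, hr⟩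
    exact ⟨by linarith, by linarith [hinv.1 hp]⟩
  · rintro ⟨hr, hp⟩
    exact ⟨⟨hinv.2 (by linarith), hch⟩, hcg, by linarith⟩
end

section
/- Let β ∈ (0,1) be real and set q = 1-β; let n ≥ 2 be a natural number, ℓ ≥ 1 a real number, and η a real number with 2^(-(n-1)) < η < 1. Set c = η^(1/(n-1)) and define h : ℝ → ℝ by h(ε) = log(1 - c·(1 - q^(ε+ℓ-1)))/log q. Let ε* = log(η^(-1/(n-1)) - 1)/log q - ℓ + 1. Then 0 < η^(-1/(n-1)) - 1 < 1 (so ε* + ℓ - 1 > 0), and the third derivative of h vanishes at ε*. -/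
/-- The third derivative of `ε ↦ log (1 - c (1 - q ^ (ε + a))) / log q`. -/
lemma iteratedDeriv_three_log_one_sub_mul_div_log {q c : ℝ} (hq0 : 0 < q) (hq1 : q ≠ 1)
    (hc0 : 0 < c) (hc1 : c < 1) (a ε : ℝ) :
    iteratedDeriv 3 (fun x => Real.log (1 - c * (1 - q ^ (x + a))) / Real.log q) ε =
      Real.log q ^ 2 * c * (1 - c) * q ^ (ε + a) * (1 - c - c * q ^ (ε + a)) /
        (1 - c * (1 - q ^ (ε + a))) ^ 3 := by
  have hL : Real.log q ≠ 0 := Real.log_ne_zero_of_pos_of_ne_one hq0 hq1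
  have hu (x : ℝ) : HasDerivAt (fun x : ℝ => q ^ (x + a)) (Real.log q * q ^ (x + a)) x := by
    have := ((hasDerivAt_id x).add_const a).const_rpow hq0
    simpa using this
  have hD (x : ℝ) : HasDerivAt (fun x : ℝ => 1 - c * (1 - q ^ (x + a)))
      (c * (Real.log q * q ^ (x + a))) x := by
    simpa using (((hu x).const_sub 1).const_mul c).const_sub 1
  have hpos (x : ℝ) : 1 - c * (1 - q ^ (x + a)) ≠ 0 := by
    have := mul_pos hc0 (Real.rpow_pos_of_pos hq0 (x + a))
    exact ne_of_gt (by linarith)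
  have h1 : deriv (fun x : ℝ => Real.log (1 - c * (1 - q ^ (x + a))) / Real.log q) =
      fun x => c * q ^ (x + a) / (1 - c * (1 - q ^ (x + a))) := by
    funext x
    refine (((hD x).log (hpos x)).div_const (Real.log q)).deriv.trans ?_
    have := hpos x
    field_simp
  have h2 : deriv (fun x : ℝ => c * q ^ (x + a) / (1 - c * (1 - q ^ (x + a)))) =
      fun x => Real.log q * c * (1 - c) * q ^ (x + a) / (1 - c * (1 - q ^ (x + a))) ^ 2 := by
    funext x
    refine (((hu x).const_mul c).div (hD x) (hpos x)).deriv.trans ?_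
    congr 1
    ring
  rw [iteratedDeriv_succ, iteratedDeriv_succ, iteratedDeriv_one, h1, h2]
  refine (((hu ε).const_mul (Real.log q * c * (1 - c))).div ((hD ε).pow 2)
    (pow_ne_zero 2 (hpos ε))).deriv.trans ?_
  have := hpos ε
  simp only [Pi.pow_apply]
  rw [div_eq_div_iff (by positivity) (by positivity)]
  push_cast
  ring

/-- Theorem 5 (phase transition): with `c = η^(1/(n-1))` and
`h(ε) = log(1 - c·(1 - q^(ε+ℓ-1)))/log q`, the third derivative of `h` vanishes at
`ε* = log(η^(-1/(n-1)) - 1)/log q - ℓ + 1`, and `0 < η^(-1/(n-1)) - 1 < 1`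
(so `ε* + ℓ - 1 > 0`). -/
theorem stmt_11 (β : ℝ) (hβ0 : 0 < β) (hβ1 : β < 1) (q : ℝ) (hq : q = 1 - β)
    (n : ℕ) (hn : 2 ≤ n) (ℓ : ℝ) (hℓ : 1 ≤ ℓ)
    (η : ℝ) (hη0 : (2 : ℝ) ^ (-((n : ℝ) - 1)) < η) (hη1 : η < 1)
    (c : ℝ) (hc : c = η ^ (1 / ((n : ℝ) - 1)))
    (h : ℝ → ℝ)
    (hh : ∀ ε, h ε = Real.log (1 - c * (1 - q ^ (ε + ℓ - 1))) / Real.log q)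
    (εstar : ℝ)
    (hεstar : εstar = Real.log (η ^ (-(1 / ((n : ℝ) - 1))) - 1) / Real.log q - ℓ + 1) :
    0 < η ^ (-(1 / ((n : ℝ) - 1))) - 1 ∧
    η ^ (-(1 / ((n : ℝ) - 1))) - 1 < 1 ∧
    0 < εstar + ℓ - 1 ∧
    iteratedDeriv 3 h εstar = 0 := by
  have hq0 : 0 < q := by linarith
  have hq1 : q < 1 := by linarith
  have hL : Real.log q < 0 := Real.log_neg hq0 hq1
  have hm : (0 : ℝ) < (n : ℝ) - 1 := by
    have : (2 : ℝ) ≤ n := by exact_mod_cast hn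
    linarith
  have hη : 0 < η := (Real.rpow_pos_of_pos two_pos _).trans hη0
  have hc0 : 0 < c := hc ▸ Real.rpow_pos_of_pos hη _
  have hc1 : c < 1 := hc ▸ Real.rpow_lt_one hη.le hη1 (by positivity)
  have hc2 : 1 / 2 < c := by
    have := Real.rpow_lt_rpow (Real.rpow_pos_of_pos two_pos _).le hη0 (one_div_pos.2 hm)
    rwa [← Real.rpow_mul two_pos.le, neg_mul, mul_one_div_cancel hm.ne', Real.rpow_neg_one,
      ← hc, ← one_div] at this
  rw [Real.rpow_neg hη.le, ← hc] at hεstar ⊢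
  have hlo : 0 < c⁻¹ - 1 := sub_pos.2 ((one_lt_inv₀ hc0).2 hc1)
  have hhi : c⁻¹ - 1 < 1 := by
    have : c⁻¹ < 2 := by
      rw [inv_lt_comm₀ hc0 two_pos, ← one_div]
      exact hc2
    linarith
  have hexp : εstar + (ℓ - 1) = Real.log (c⁻¹ - 1) / Real.log q := by
    rw [hεstar]
    ring
  have hu : q ^ (εstar + (ℓ - 1)) = c⁻¹ - 1 := by
    rw [hexp, Real.rpow_def_of_pos hq0, mul_div_cancel₀ _ hL.ne, Real.exp_log hlo]
  refine ⟨hlo, hhi, ?_, ?_⟩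
  · rw [add_sub_assoc, hexp]
    exact div_pos_of_neg_of_neg (Real.log_neg hlo hhi) hL
  · have hfun : h = fun x => Real.log (1 - c * (1 - q ^ (x + (ℓ - 1)))) / Real.log q := by
      funext x
      rw [hh, add_sub_assoc]
    have hzero : 1 - c - c * (c⁻¹ - 1) = 0 := by
      field_simp
      ring
    rw [hfun, iteratedDeriv_three_log_one_sub_mul_div_log hq0 hq1.ne hc0 hc1, hu, hzero]
    simp
end

section
/- Let β ∈ (0,1) be real and set q = 1-β; let n ≥ 2 be a natural number and let ε ≥ 0 and ℓ > 0 be real numbers. Then ((1 - q^ℓ)/(1 - q^(ε+ℓ)))^(n-1) ≥ 1/2 if and only if ℓ ≥ log((2^(1/(n-1)) - 1)/(2^(1/(n-1)) - q^ε))/log q. -/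
/-- Recall of the quasi-synchronous monitor is at least `1/2` iff
`ℓ ≥ log((2^(1/(n-1)) - 1)/(2^(1/(n-1)) - q^ε))/log q`, where `q = 1-β`. -/
theorem stmt_13 (β : ℝ) (hβ0 : 0 < β) (hβ1 : β < 1) (q : ℝ) (hq : q = 1 - β)
    (n : ℕ) (hn : 2 ≤ n) (ε : ℝ) (hε : 0 ≤ ε) (ℓ : ℝ) (hℓ : 0 < ℓ) :
    ((1 - q ^ ℓ) / (1 - q ^ (ε + ℓ))) ^ (n - 1) ≥ 1 / 2 ↔
    ℓ ≥ Real.log (((2 : ℝ) ^ (1 / ((n : ℝ) - 1)) - 1) /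
      ((2 : ℝ) ^ (1 / ((n : ℝ) - 1)) - q ^ ε)) / Real.log q := by
  have hq0 : 0 < q := by linarith
  have hq1 : q < 1 := by linarith
  have hlog : Real.log q < 0 := Real.log_neg hq0 hq1
  have hn1 : n - 1 ≠ 0 := by omega
  have hcast : ((n - 1 : ℕ) : ℝ) = (n : ℝ) - 1 := by
    rw [Nat.cast_sub (by omega), Nat.cast_one]
  have hnpos : (0 : ℝ) < (n : ℝ) - 1 := by
    rw [← hcast]; exact_mod_cast Nat.pos_of_ne_zero hn1
  have ha1 : 1 < (2 : ℝ) ^ (1 / ((n : ℝ) - 1)) :=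
    Real.one_lt_rpow one_lt_two (by positivity)
  have hapow : ((2 : ℝ) ^ (1 / ((n : ℝ) - 1))) ^ (n - 1) = 2 := by
    rw [← hcast, one_div]
    exact Real.rpow_inv_natCast_pow zero_le_two hn1
  generalize (2 : ℝ) ^ (1 / ((n : ℝ) - 1)) = a at ha1 hapow ⊢
  have hx0 : 0 < q ^ ℓ := Real.rpow_pos_of_pos hq0 ℓ
  have hx1 : q ^ ℓ < 1 := Real.rpow_lt_one hq0.le hq1 hℓ
  have he1 : q ^ ε ≤ 1 := Real.rpow_le_one hq0.le hq1.le hε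
  have hden : 0 < 1 - q ^ ε * q ^ ℓ := by nlinarith
  have hae : 0 < a - q ^ ε := by linarith
  have hA : 0 < (a - 1) / (a - q ^ ε) := div_pos (by linarith) hae
  have ha0 : 0 < a := by linarith
  rw [ge_iff_le, ge_iff_le, Real.rpow_add hq0, div_le_iff_of_neg hlog,
    ← Real.log_rpow hq0, Real.log_le_log_iff hx0 hA, le_div_iff₀ hae, ← hapow,
    ← one_div_pow, pow_le_pow_iff_left₀ (by positivity)
      (div_nonneg (by linarith) hden.le) hn1, div_le_div_iff₀ ha0 hden]
  constructor <;> intro h <;> linarith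
end
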